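/- Let s ∈ (1/2, 1] and let x ∈ (0,1) be irrational with approximation rate r_odd(x). If s − 1 + 1/r_odd(x) < 0 (with the convention 1/∞ = 0), then the sequence of partial sums F_{s,N}(x) does not converge as N → ∞. -/

import Mathlib

open MeasureTheory Filter Set
open scoped Real BigOperators ENNReal

/-- Partial sum `F_{s,N}(x) = ∑_{n=1}^N n^{-s} e^{2πi n² x}`. -/
noncomputable def FsN (s : ℝ) (N : ℕ) (x : ℝ) : ℂ :=
  ∑ n ∈ Finset.Icc 1 N,
    (((n : ℝ) ^ (-s) : ℝ) : ℂ) * Complex.exp (2 * Real.pi * Complex.I * (n : ℂ) ^ 2 * (x : ℂ))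

/-- Iterates of the Gauss map: `cfX x 0 = x`, `cfX x (j+1) = frac (1 / cfX x j)`. -/
noncomputable def cfX (x : ℝ) : ℕ → ℝ
  | 0 => x
  | j + 1 => Int.fract (cfX x j)⁻¹

/-- Partial quotients: `cfA x j = a_{j+1} = ⌊1 / x_j⌋`. -/
noncomputable def cfA (x : ℝ) (j : ℕ) : ℤ := ⌊(cfX x j)⁻¹⌋

/-- Numerators of the convergents of x ∈ (0,1): `p_0 = 0`, `p_1 = 1`,
`p_{j+2} = a_{j+2} p_{j+1} + p_j`. -/
noncomputable def cfP (x : ℝ) : ℕ → ℤ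
  | 0 => 0
  | 1 => 1
  | j + 2 => cfA x (j + 1) * cfP x (j + 1) + cfP x j

/-- Denominators of the convergents of x ∈ (0,1): `q_0 = 1`, `q_1 = a_1`,
`q_{j+2} = a_{j+2} q_{j+1} + q_j`. -/
noncomputable def cfQ (x : ℝ) : ℕ → ℤ
  | 0 => 1
  | 1 => cfA x 0
  | j + 2 => cfA x (j + 1) * cfQ x (j + 1) + cfQ x j

/-- `h_j = x - p_j/q_j`. -/
noncomputable def cfH (x : ℝ) (j : ℕ) : ℝ := x - (cfP x j : ℝ) / (cfQ x j : ℝ)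

/-- `r_j`, defined by `|h_j| = q_j^{-r_j}`, i.e. `r_j = -log_{q_j} |h_j|`. -/
noncomputable def cfR (x : ℝ) (j : ℕ) : ℝ := -Real.logb (cfQ x j : ℝ) |cfH x j|

/-- The filter of large indices `j ≥ 1` whose convergent denominator `q_j` is not
twice an odd number (i.e. `q_j ≢ 2 [MOD 4]`). -/
def oddFilter (x : ℝ) : Filter ℕ :=
  Filter.atTop ⊓ Filter.principal {j : ℕ | 1 ≤ j ∧ cfQ x j % 4 ≠ 2}

/-- The approximation rate `r_odd(x) ∈ [2,∞]`: the limsup of the `r_j` over indices `j`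
with `q_j ≢ 2 [MOD 4]`. -/
noncomputable def rOdd (x : ℝ) : ℝ≥0∞ :=
  Filter.limsup (fun j => ENNReal.ofReal (cfR x j)) (oddFilter x)

/-- `δ_j`: equal to `1` when `s < 1`, and to `log (q_{j+1}/q_j)` when `s = 1`. -/
noncomputable def deltaJ (s x : ℝ) (j : ℕ) : ℝ :=
  if s < 1 then 1 else Real.log ((cfQ x (j + 1) : ℝ) / (cfQ x j : ℝ))

/-- The summand `δ_j √(q_{j+1} / (q_j q_{j+1})^s)`. -/
noncomputable def sigTerm (s x : ℝ) (j : ℕ) : ℝ :=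
  deltaJ s x j *
    Real.sqrt ((cfQ x (j + 1) : ℝ) / ((cfQ x j : ℝ) * (cfQ x (j + 1) : ℝ)) ^ s)

/-- `Σ_s(x) = ∑_{j ≥ 1, q_j ≢ 2 (4)} δ_j √(q_{j+1}/(q_j q_{j+1})^s)`, valued in `[0,∞]`. -/
noncomputable def SigmaS (s x : ℝ) : ℝ≥0∞ :=
  ∑' j : ℕ, if 1 ≤ j ∧ cfQ x j % 4 ≠ 2 then ENNReal.ofReal (sigTerm s x j) else 0


open Finset in
lemma aux_gauss (q : ℕ) [NeZero q] (p : ℤ) (hcop : IsCoprime p (q : ℤ)) (hq : q % 4 ≠ 2) :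
    (q : ℝ) ≤ ‖∑ n ∈ Finset.range q,
      Complex.exp (2 * Real.pi * Complex.I * (n : ℂ) ^ 2 * ((p : ℂ) / (q : ℂ)))‖ ^ 2 := by
  have key : ∑ n ∈ Finset.range q,
      Complex.exp (2 * Real.pi * Complex.I * (n : ℂ) ^ 2 * ((p : ℂ) / (q : ℂ)))
      = ∑ a : ZMod q, ZMod.stdAddChar ((p : ZMod q) * a ^ 2) := by
    rw [← Fin.sum_univ_eq_sum_range (fun n => Complex.exp (2 * Real.pi * Complex.I * (n : ℂ) ^ 2 * ((p : ℂ) / (q : ℂ))))]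
    refine Fintype.sum_bijective (fun i : Fin q => ((i : ℕ) : ZMod q)) ?_ _ _ ?_
    · rw [Fintype.bijective_iff_injective_and_card]
      refine ⟨?_, by simp [ZMod.card]⟩
      intro a b hab
      have := (ZMod.natCast_eq_natCast_iff' _ _ _).1 hab
      rw [Nat.mod_eq_of_lt a.2, Nat.mod_eq_of_lt b.2] at this
      exact Fin.ext this
    · intro i
      have h1 : (p : ZMod q) * ((i : ℕ) : ZMod q) ^ 2 = ((p * (i : ℕ) ^ 2 : ℤ) : ZMod q) := by
        push_cast; ring
      simp only [h1, ZMod.stdAddChar_coe]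
      congr 1
      push_cast
      ring
  rw [key]
  have hpu : IsUnit (p : ZMod q) := (ZMod.coe_int_isUnit_iff_isCoprime p q).2 hcop.symm
  have hsq : ((‖∑ a : ZMod q, ZMod.stdAddChar ((p : ZMod q) * a ^ 2)‖ ^ 2 : ℝ) : ℂ)
      = ∑ d : ZMod q, if 2 * d = 0 then (q : ℂ) else 0 := by
    push_cast
    rw [← Complex.mul_conj', map_sum, Finset.sum_mul_sum, Finset.sum_comm]
    have h1 : ∀ b : ZMod q, ∑ a : ZMod q, ZMod.stdAddChar ((p : ZMod q) * a ^ 2) *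
        (starRingEnd ℂ) (ZMod.stdAddChar ((p : ZMod q) * b ^ 2))
        = ∑ d : ZMod q, ZMod.stdAddChar ((p : ZMod q) * d ^ 2) *
          ZMod.stdAddChar (b * (2 * (p : ZMod q) * d)) := by
      intro b
      rw [← Equiv.sum_comp (Equiv.addRight b)]
      refine Finset.sum_congr rfl fun d _ => ?_
      rw [← AddChar.map_neg_eq_conj, ← AddChar.map_add_eq_mul, ← AddChar.map_add_eq_mul]
      congr 1
      simp only [Equiv.coe_addRight]
      ring
    rw [Finset.sum_congr rfl fun b _ => h1 b, Finset.sum_comm]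
    refine Finset.sum_congr rfl fun d _ => ?_
    rw [← Finset.mul_sum, AddChar.sum_mulShift _ (ZMod.isPrimitive_stdAddChar q)]
    have h2 : (2 * (p : ZMod q) * d = 0) ↔ 2 * d = 0 := by
      rw [show 2 * (p : ZMod q) * d = p * (2 * d) by ring, hpu.mul_right_eq_zero]
    simp only [h2, ZMod.card]
    split_ifs with h3
    · have hd : d ^ 2 = 0 := by
        have hd' : ((d.val : ℕ) : ZMod q) = d := ZMod.natCast_zmod_val d
        rw [← hd'] at h3 ⊢
        have h4 : q ∣ 2 * d.val := by
          rw [← ZMod.natCast_eq_zero_iff]; push_cast; exact h3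
        have h5 : q ∣ d.val ^ 2 := by
          clear h3 hd'
          generalize d.val = v at h4 ⊢
          rcases Nat.even_or_odd q with he | ho
          · obtain ⟨m, hm⟩ : 4 ∣ q := by
              obtain ⟨k, hk⟩ := he
              omega
            obtain ⟨t, ht⟩ := h4
            have : v = 2 * m * t := by
              rw [hm] at ht
              have : 2 * v = 2 * (2 * m * t) := by rw [ht]; ring
              omega
            rw [this]
            exact ⟨m * t ^ 2, by rw [hm]; ring⟩
          · have : q ∣ v := (Nat.Coprime.dvd_of_dvd_mul_left (Nat.coprime_two_right.2 ho) h4)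
            exact Dvd.dvd.pow this (by norm_num)
        rw [← ZMod.natCast_eq_zero_iff] at h5
        exact_mod_cast h5
      simp [hd]
    · simp
  have hsq' : ‖∑ a : ZMod q, ZMod.stdAddChar ((p : ZMod q) * a ^ 2)‖ ^ 2
      = ∑ d : ZMod q, if 2 * d = 0 then (q : ℝ) else 0 := by
    apply Complex.ofReal_injective
    rw [hsq]
    rw [Complex.ofReal_sum]
    refine Finset.sum_congr rfl fun d _ => ?_
    split_ifs <;> simp
  rw [hsq']
  have := Finset.single_le_sum (f := fun d : ZMod q => if 2 * d = 0 then (q : ℝ) else 0)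
    (fun d _ => by positivity) (Finset.mem_univ 0)
  simpa using this

lemma aux_period (f : ℕ → ℂ) (q : ℕ) (hf : ∀ n, f (n + q) = f n) (K : ℕ) :
    ∑ n ∈ Finset.range (K * q), f n = K * ∑ n ∈ Finset.range q, f n := by
  induction K with
  | zero => simp
  | succ K ih =>
    rw [Nat.succ_mul, Finset.sum_range_add, ih]
    have : ∀ n, f (K * q + n) = f n := by
      intro n
      clear ih
      induction K with
      | zero => simp
      | succ K ih => rw [← ih, ← hf (K * q + n)]; congr 1; ring
    simp only [this]
    push_cast
    ring

lemma aux_exp_period (q : ℕ) (hq : 0 < q) (p : ℤ) (n : ℕ) :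
    Complex.exp (2 * Real.pi * Complex.I * ((n + q : ℕ) : ℂ) ^ 2 * ((p : ℂ) / (q : ℂ))) =
    Complex.exp (2 * Real.pi * Complex.I * (n : ℂ) ^ 2 * ((p : ℂ) / (q : ℂ))) := by
  rw [Complex.exp_eq_exp_iff_exists_int]
  refine ⟨p * (2 * n + q), ?_⟩
  have : (q : ℂ) ≠ 0 := by exact_mod_cast hq.ne'
  push_cast
  field_simp
  ring

lemma aux_gauss_sum (q : ℕ) (hq0 : 0 < q) (p : ℤ) (hcop : IsCoprime p (q : ℤ)) (hq : q % 4 ≠ 2)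
    (K : ℕ) : (K : ℝ) * √q ≤ ‖∑ n ∈ Finset.range (K * q),
      Complex.exp (2 * Real.pi * Complex.I * ((n + 1 : ℕ) : ℂ) ^ 2 * ((p : ℂ) / (q : ℂ)))‖ := by
  have : NeZero q := ⟨hq0.ne'⟩
  set f : ℕ → ℂ := fun n =>
    Complex.exp (2 * Real.pi * Complex.I * (n : ℂ) ^ 2 * ((p : ℂ) / (q : ℂ))) with hf
  have hper : ∀ n, f (n + q) = f n := aux_exp_period q hq0 p
  have h1 := aux_period (fun n => f (n + 1)) q
    (fun n => by show f (n + q + 1) = _; rw [← hper (n+1)]; congr 1; ring) K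
  have h2 : ∑ n ∈ Finset.range q, f (n + 1) = ∑ n ∈ Finset.range q, f n := by
    have a := Finset.sum_range_succ f q
    rw [Finset.sum_range_succ'] at a
    have := hper 0
    rw [zero_add] at this
    rw [this] at a
    exact add_right_cancel a
  have h3 := aux_gauss q p hcop hq
  change (K : ℝ) * √q ≤ ‖∑ n ∈ Finset.range (K * q), f (n + 1)‖
  rw [h1, h2, norm_mul, Complex.norm_natCast]
  gcongr
  exact Real.sqrt_le_left (norm_nonneg _) |>.2 h3

lemma aux_abel (a w : ℕ → ℂ) (N : ℕ) :
    ∑ n ∈ Finset.range N, a n * w n = (∑ n ∈ Finset.range N, a n) * w N -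
      ∑ n ∈ Finset.range N, (∑ m ∈ Finset.range (n + 1), a m) * (w (n + 1) - w n) := by
  induction N with
  | zero => simp
  | succ N ih =>
    rw [Finset.sum_range_succ, ih, Finset.sum_range_succ (fun n => (∑ m ∈ Finset.range (n + 1), a m) * (w (n + 1) - w n)), Finset.sum_range_succ a]
    ring

lemma aux_abel_bound (a w : ℕ → ℂ) (T : ℕ → ℝ) (B : ℝ)
    (hB : ∀ N, ‖∑ n ∈ Finset.range N, a n‖ ≤ B)
    (hT0 : 0 ≤ T 0) (hw : ∀ n, ‖w n‖ ≤ T n) (hT : ∀ n, ‖w (n + 1) - w n‖ ≤ T (n + 1) - T n) (N : ℕ) :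
    ‖∑ n ∈ Finset.range N, a n * w n‖ ≤ 2 * B * T N := by
  have hB0 : 0 ≤ B := (norm_nonneg _).trans (hB 0)
  rw [aux_abel]
  calc _ ≤ ‖(∑ n ∈ Finset.range N, a n) * w N‖ +
      ‖∑ n ∈ Finset.range N, (∑ m ∈ Finset.range (n + 1), a m) * (w (n + 1) - w n)‖ := norm_sub_le _ _
    _ ≤ B * T N + ∑ n ∈ Finset.range N, B * (T (n + 1) - T n) := by
      gcongr
      · rw [norm_mul]; gcongr
        · exact hB N
        · exact hw N
      · refine norm_sum_le_of_le _ fun n _ => ?_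
        rw [norm_mul]; gcongr
        · exact hB _
        · exact hT n
    _ = B * T N + B * (T N - T 0) := by
      rw [← Finset.mul_sum, Finset.sum_range_sub]
    _ ≤ _ := by nlinarith [mul_nonneg hB0 hT0]

lemma aux_exp_diff (u v : ℝ) :
    ‖Complex.exp (u * Complex.I) - Complex.exp (v * Complex.I)‖ ≤ |u - v| := by
  have h : Complex.exp (u * Complex.I) - Complex.exp (v * Complex.I) =
      Complex.exp (v * Complex.I) * (Complex.exp (Complex.I * ((u - v : ℝ) : ℂ)) - 1) := by
    rw [mul_sub, ← Complex.exp_add]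
    push_cast
    congr 2
    · ring
    · ring
  rw [h, norm_mul, Complex.norm_exp_ofReal_mul_I, one_mul]
  exact Real.norm_exp_I_mul_ofReal_sub_one_le

lemma aux_FsN (s x : ℝ) (N : ℕ) : FsN s N x = ∑ n ∈ Finset.range N,
    ((((n + 1 : ℕ) : ℝ) ^ (-s) : ℝ) : ℂ) *
      Complex.exp (2 * Real.pi * Complex.I * ((n + 1 : ℕ) : ℂ) ^ 2 * (x : ℂ)) := by
  unfold FsN
  induction N with
  | zero => simp
  | succ N ih => rw [Finset.sum_Icc_succ_top (by omega), ih, Finset.sum_range_succ]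

lemma aux_main_bound (s x B : ℝ) (hs0 : 0 ≤ s) (hB : ∀ N, ‖FsN s N x‖ ≤ B)
    (q : ℕ) (hq0 : 0 < q) (p : ℤ) (hcop : IsCoprime p (q : ℤ)) (hq : q % 4 ≠ 2) (K : ℕ) :
    (K : ℝ) * √q ≤ 2 * B * (((K * q + 1 : ℕ) : ℝ) ^ s *
      (1 + 2 * π * |x - p / q| * ((K * q + 1 : ℕ) : ℝ) ^ 2)) := by
  refine (aux_gauss_sum q hq0 p hcop hq K).trans ?_
  set h : ℝ := x - p / q with hh
  set w : ℕ → ℂ := fun n => ((((n + 1 : ℕ) : ℝ) ^ s : ℝ) : ℂ) *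
    Complex.exp (((-2 * π * h * ((n + 1 : ℕ) : ℝ) ^ 2 : ℝ) : ℂ) * Complex.I) with hw
  have := aux_abel_bound (fun n => ((((n + 1 : ℕ) : ℝ) ^ (-s) : ℝ) : ℂ) *
      Complex.exp (2 * Real.pi * Complex.I * ((n + 1 : ℕ) : ℂ) ^ 2 * (x : ℂ))) w
    (fun n => ((n + 1 : ℕ) : ℝ) ^ s * (1 + 2 * π * |h| * ((n + 1 : ℕ) : ℝ) ^ 2)) B
    (fun N => by rw [← aux_FsN]; exact hB N) (by positivity) ?_ ?_ (K * q)
  · refine le_trans (le_of_eq ?_) this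
    congr 1
    refine Finset.sum_congr rfl fun n _ => ?_
    have hpos : (0 : ℝ) < ((n + 1 : ℕ) : ℝ) := by positivity
    have e1 : ((((n + 1 : ℕ) : ℝ) ^ (-s) : ℝ) : ℂ) * ((((n + 1 : ℕ) : ℝ) ^ s : ℝ) : ℂ) = 1 := by
      rw [← Complex.ofReal_mul, ← Real.rpow_add hpos]; simp
    simp only [hw]
    rw [mul_mul_mul_comm, e1, one_mul, ← Complex.exp_add]
    congr 1
    rw [hh]
    push_cast
    ring
  · intro n
    simp only [hw]
    rw [norm_mul, Complex.norm_exp_ofReal_mul_I, mul_one, Complex.norm_real, Real.norm_of_nonneg (by positivity)]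
    refine le_mul_of_one_le_right (by positivity) ?_
    have : 0 ≤ 2 * π * |h| * ((n + 1 : ℕ) : ℝ) ^ 2 := by positivity
    linarith
  · intro n
    simp only [hw]
    set E1 := Complex.exp (((-2 * π * h * ((n + 1 : ℕ) : ℝ) ^ 2 : ℝ) : ℂ) * Complex.I)
    set E2 := Complex.exp (((-2 * π * h * ((n + 1 + 1 : ℕ) : ℝ) ^ 2 : ℝ) : ℂ) * Complex.I)
    have hE : ‖E2 - E1‖ ≤ 2 * π * |h| * (((n + 1 + 1 : ℕ) : ℝ) ^ 2 - ((n + 1 : ℕ) : ℝ) ^ 2) := by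
      refine (aux_exp_diff _ _).trans (le_of_eq ?_)
      have hm : 0 ≤ (((n + 1 + 1 : ℕ) : ℝ) ^ 2 - ((n + 1 : ℕ) : ℝ) ^ 2) := by
        push_cast; ring_nf; positivity
      rw [← mul_sub, abs_mul, abs_of_nonneg hm, abs_mul, abs_mul, abs_neg, abs_of_pos Real.pi_pos]
      norm_num
    have hE2 : ‖E2‖ = 1 := Complex.norm_exp_ofReal_mul_I _
    have hm : ((n + 1 : ℕ) : ℝ) ^ s ≤ ((n + 1 + 1 : ℕ) : ℝ) ^ s := by
      apply Real.rpow_le_rpow (by positivity) _ hs0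
      push_cast; linarith
    set u := ((n + 1 : ℕ) : ℝ) ^ s
    set v := ((n + 1 + 1 : ℕ) : ℝ) ^ s
    have hu : 0 ≤ u := by positivity
    have hid : (v : ℂ) * E2 - (u : ℂ) * E1 = ((v - u : ℝ) : ℂ) * E2 + (u : ℂ) * (E2 - E1) := by
      push_cast; ring
    rw [hid]
    refine (norm_add_le _ _).trans ?_
    rw [norm_mul, norm_mul, hE2, Complex.norm_real, Complex.norm_real,
      Real.norm_of_nonneg hu, Real.norm_of_nonneg (sub_nonneg.2 hm)]
    have hz : 0 ≤ (v - u) * (2 * π * |h| * ((n + 1 + 1 : ℕ) : ℝ) ^ 2) :=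
      mul_nonneg (sub_nonneg.2 hm) (by positivity)
    have := mul_le_mul_of_nonneg_left hE hu
    nlinarith

/-! continued fractions -/

lemma aux_cfX (x : ℝ) (hx : x ∈ Set.Ioo (0 : ℝ) 1) (hirr : Irrational x) (j : ℕ) :
    cfX x j ∈ Set.Ioo (0 : ℝ) 1 ∧ Irrational (cfX x j) := by
  induction j with
  | zero => exact ⟨hx, hirr⟩
  | succ j ih =>
    have h1 : Irrational (cfX x j)⁻¹ := irrational_inv_iff.2 ih.2
    have h2 : Irrational (cfX x (j + 1)) := by
      show Irrational (Int.fract _)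
      unfold Int.fract
      exact h1.sub_intCast _
    refine ⟨⟨lt_of_le_of_ne (Int.fract_nonneg _) ?_, Int.fract_lt_one _⟩, h2⟩
    exact fun h => h2.ne_zero h.symm

lemma aux_cfA (x : ℝ) (hx : x ∈ Set.Ioo (0 : ℝ) 1) (hirr : Irrational x) (j : ℕ) :
    1 ≤ cfA x j := by
  have h := (aux_cfX x hx hirr j).1
  unfold cfA
  rw [Int.le_floor]
  push_cast
  exact (one_le_inv₀ h.1).2 h.2.le

lemma aux_cfA_eq (x : ℝ) (hx : x ∈ Set.Ioo (0 : ℝ) 1) (hirr : Irrational x) (j : ℕ) :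
    cfX x j * (cfA x j + cfX x (j + 1)) = 1 := by
  have h := (aux_cfX x hx hirr j).1
  show cfX x j * ((⌊(cfX x j)⁻¹⌋ : ℝ) + Int.fract (cfX x j)⁻¹) = 1
  rw [Int.floor_add_fract, mul_inv_cancel₀ h.1.ne']

lemma aux_cfQ_pos (x : ℝ) (hx : x ∈ Set.Ioo (0 : ℝ) 1) (hirr : Irrational x) (j : ℕ) :
    1 ≤ cfQ x j ∧ 1 ≤ cfQ x (j + 1) := by
  induction j with
  | zero => exact ⟨le_refl _, aux_cfA x hx hirr 0⟩
  | succ j ih =>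
    refine ⟨ih.2, ?_⟩
    show 1 ≤ cfA x (j + 1) * cfQ x (j + 1) + cfQ x j
    nlinarith [aux_cfA x hx hirr (j + 1)]

lemma aux_cfQ_ge (x : ℝ) (hx : x ∈ Set.Ioo (0 : ℝ) 1) (hirr : Irrational x) (j : ℕ) :
    (j : ℤ) ≤ cfQ x j ∧ (j : ℤ) + 1 ≤ cfQ x (j + 1) := by
  induction j with
  | zero => exact ⟨by simp [cfQ], by simpa using (aux_cfQ_pos x hx hirr 0).2⟩
  | succ j ih =>
    refine ⟨by exact_mod_cast ih.2, ?_⟩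
    show ((j + 1 : ℕ) : ℤ) + 1 ≤ cfA x (j + 1) * cfQ x (j + 1) + cfQ x j
    push_cast
    nlinarith [aux_cfA x hx hirr (j + 1), (aux_cfQ_pos x hx hirr j).1]

lemma aux_det (x : ℝ) (j : ℕ) :
    cfP x (j + 1) * cfQ x j - cfP x j * cfQ x (j + 1) = (-1) ^ j := by
  induction j with
  | zero => simp [cfP, cfQ]
  | succ j ih =>
    show (cfA x (j + 1) * cfP x (j + 1) + cfP x j) * cfQ x (j + 1) -
      cfP x (j + 1) * (cfA x (j + 1) * cfQ x (j + 1) + cfQ x j) = _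
    rw [pow_succ, ← ih]; ring

lemma aux_cop (x : ℝ) (j : ℕ) : IsCoprime (cfP x j) (cfQ x j) := by
  have h := aux_det x j
  have h2 : ((-1 : ℤ) ^ j) * (-1) ^ j = 1 := by rw [← mul_pow]; simp
  exact ⟨-(-1) ^ j * cfQ x (j + 1), (-1) ^ j * cfP x (j + 1), by
    linear_combination (-1) ^ j * h + h2⟩

lemma aux_copQ (x : ℝ) (j : ℕ) : IsCoprime (cfQ x j) (cfQ x (j + 1)) := by
  have h := aux_det x j
  have h2 : ((-1 : ℤ) ^ j) * (-1) ^ j = 1 := by rw [← mul_pow]; simp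
  exact ⟨(-1) ^ j * cfP x (j + 1), -(-1) ^ j * cfP x j, by
    linear_combination (-1) ^ j * h + h2⟩

lemma aux_formula (x : ℝ) (hx : x ∈ Set.Ioo (0 : ℝ) 1) (hirr : Irrational x) (j : ℕ) :
    x * (cfQ x (j + 1) + cfX x (j + 1) * cfQ x j) = cfP x (j + 1) + cfX x (j + 1) * cfP x j := by
  induction j with
  | zero =>
    have := aux_cfA_eq x hx hirr 0
    simp only [cfP, cfQ]
    change x * _ = 1 at this
    push_cast
    linarith
  | succ j ih =>
    have h := aux_cfA_eq x hx hirr (j + 1)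
    have h0 := (aux_cfX x hx hirr (j + 1)).1.1
    show x * (((cfA x (j + 1) * cfQ x (j + 1) + cfQ x j : ℤ) : ℝ) + cfX x (j + 2) * cfQ x (j + 1)) =
      ((cfA x (j + 1) * cfP x (j + 1) + cfP x j : ℤ) : ℝ) + cfX x (j + 2) * cfP x (j + 1)
    apply mul_left_cancel₀ h0.ne'
    push_cast
    change cfX x (j + 1) * (cfA x (j + 1) + cfX x (j + 2)) = 1 at h
    linear_combination ih + (x * cfQ x (j + 1) - cfP x (j + 1)) * h

lemma aux_H (x : ℝ) (hx : x ∈ Set.Ioo (0 : ℝ) 1) (hirr : Irrational x) (j : ℕ) :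
    |cfH x (j + 1)| ≤ ((cfQ x (j + 1) : ℝ))⁻¹ := by
  have hq : (1 : ℝ) ≤ cfQ x (j + 1) := by exact_mod_cast (aux_cfQ_pos x hx hirr j).2
  have hq' : (1 : ℝ) ≤ cfQ x j := by exact_mod_cast (aux_cfQ_pos x hx hirr j).1
  have ht := (aux_cfX x hx hirr (j + 1)).1
  have hf := aux_formula x hx hirr j
  have hd : (cfP x (j + 1) * cfQ x j - cfP x j * cfQ x (j + 1) : ℝ) = (-1) ^ j := by
    exact_mod_cast aux_det x j
  set Q : ℝ := (cfQ x (j + 1) : ℝ)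
  set Q' : ℝ := (cfQ x j : ℝ)
  set t := cfX x (j + 1)
  have hD : 1 ≤ Q + t * Q' := by nlinarith [ht.1]
  have e : cfH x (j + 1) = -(t * (-1) ^ j) / (Q + t * Q') * Q⁻¹ := by
    rw [← hd]
    unfold cfH
    have : (Q + t * Q') ≠ 0 := by linarith
    have h3 : Q ≠ 0 := by linarith
    change x - _ / Q = _
    field_simp
    linear_combination Q * hf
  have e2 : |cfH x (j + 1)| = t / (Q + t * Q') * Q⁻¹ := by
    rw [e, abs_mul, abs_div, abs_neg, abs_mul, abs_pow, abs_neg, abs_one, one_pow, mul_one,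
      abs_of_pos ht.1, abs_of_pos (by linarith : 0 < Q + t * Q'), abs_of_pos (by positivity : 0 < Q⁻¹)]
  rw [e2]
  have : t / (Q + t * Q') ≤ 1 := by
    rw [div_le_one (by linarith)]; linarith [ht.2]
  exact mul_le_of_le_one_left (by positivity) this

lemma aux_H_ne (x : ℝ) (hirr : Irrational x) (j : ℕ) : cfH x j ≠ 0 := by
  unfold cfH
  intro h
  have : x = ((cfP x j / cfQ x j : ℚ) : ℝ) := by push_cast; linarith
  exact hirr ⟨_, this.symm⟩

lemma aux_rOdd (x : ℝ) (hx : x ∈ Set.Ioo (0 : ℝ) 1) (hirr : Irrational x) : 1 ≤ rOdd x := by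
  unfold rOdd
  refine Filter.le_limsup_of_frequently_le ?_
  unfold oddFilter
  rw [Filter.frequently_inf_principal, Filter.frequently_atTop]
  intro a
  have key : ∀ j, 2 ≤ j → 1 ≤ ENNReal.ofReal (cfR x j) := by
    intro j hj
    obtain ⟨k, rfl⟩ : ∃ k, j = k + 1 := ⟨j - 1, by omega⟩
    have hq : (2 : ℝ) ≤ cfQ x (k + 1) := by
      have := (aux_cfQ_ge x hx hirr (k + 1)).1
      have : (2 : ℤ) ≤ cfQ x (k + 1) := by omega
      exact_mod_cast this
    rw [ENNReal.one_le_ofReal]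
    unfold cfR
    rw [le_neg, Real.logb_le_iff_le_rpow (by linarith) (abs_pos.2 (aux_H_ne x hirr _)), Real.rpow_neg_one]
    exact aux_H x hx hirr k
  by_cases h : cfQ x (a + 2) % 4 = 2
  · refine ⟨a + 3, by omega, ⟨by omega, ?_⟩, key _ (by omega)⟩
    intro h'
    have hc := aux_copQ x (a + 2)
    have := hc.isUnit_of_dvd' (x := 2) (by omega) (by show 2 ∣ cfQ x (a+3); omega)
    rw [Int.isUnit_iff] at this
    omega
  · exact ⟨a + 2, by omega, ⟨by omega, h⟩, key _ (by omega)⟩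

set_option maxHeartbeats 1000000 in
theorem not_converges_of_rOdd_condition (s : ℝ) (hs : s ∈ Set.Ioc (1/2 : ℝ) 1)
    (x : ℝ) (hx : x ∈ Set.Ioo (0 : ℝ) 1) (hirr : Irrational x)
    (hcond : s - 1 + ((rOdd x)⁻¹).toReal < 0) :
    ¬ ∃ L : ℂ, Filter.Tendsto (fun N : ℕ => FsN s N x) Filter.atTop (nhds L) := by
  rintro ⟨L, hL⟩
  obtain ⟨B, hB⟩ : ∃ B, ∀ N, ‖FsN s N x‖ ≤ B := by
    obtain ⟨B, hB⟩ := (Metric.isBounded_range_of_tendsto _ hL).exists_norm_le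
    exact ⟨B, fun N => hB _ ⟨N, rfl⟩⟩
  have hB0 : 0 ≤ B := (norm_nonneg _).trans (hB 0)
  have hs0 : 0 < s := by linarith [hs.1]
  have h1s : 0 < 1 - s := by
    have : 0 ≤ ((rOdd x)⁻¹).toReal := ENNReal.toReal_nonneg
    linarith
  have hr : ENNReal.ofReal (1 / (1 - s)) < rOdd x := by
    have hne : (rOdd x)⁻¹ ≠ ⊤ := by
      rw [ENNReal.inv_ne_top]
      exact (lt_of_lt_of_le one_pos (aux_rOdd x hx hirr)).ne'
    have h2 : (rOdd x)⁻¹ < ENNReal.ofReal (1 - s) :=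
      (ENNReal.lt_ofReal_iff_toReal_lt hne).2 (by linarith)
    rw [one_div, ENNReal.ofReal_inv_of_pos h1s]
    exact ENNReal.inv_lt_iff_inv_lt.1 h2
  obtain ⟨ρ', h1, h2⟩ := exists_between hr
  have hρtop : ρ' ≠ ⊤ := ne_top_of_lt h2
  set ρ := ρ'.toReal with hρ
  have hρ1 : 1 < ρ * (1 - s) := by
    have := (ENNReal.ofReal_lt_iff_lt_toReal (by positivity) hρtop).1 h1
    rwa [div_lt_iff₀ h1s] at this
  have hρ2 : 2 ≤ ρ := by nlinarith [hs.1]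
  have hfreq := Filter.frequently_lt_of_lt_limsup (by isBoundedDefault) h2
  unfold oddFilter at hfreq
  rw [Filter.frequently_inf_principal] at hfreq
  set e := ρ * (1 - s) / 2 - 1 / 2 with he
  have he0 : 0 < e := by rw [he]; linarith
  have htend : Filter.Tendsto (fun j : ℕ => (j : ℝ) ^ e) Filter.atTop Filter.atTop :=
    (tendsto_rpow_atTop he0).comp tendsto_natCast_atTop_atTop
  obtain ⟨j, ⟨⟨hj1, hj4⟩, hjr⟩, hjbig, hj2⟩ := (hfreq.and_eventually
    ((htend.eventually_gt_atTop (240 * B)).and (Filter.eventually_ge_atTop 2))).exists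
  -- the convergent
  have hqj := (aux_cfQ_ge x hx hirr j).1
  obtain ⟨q, hq⟩ : ∃ q : ℕ, cfQ x j = q := ⟨(cfQ x j).toNat, by omega⟩
  have hjq : j ≤ q := by omega
  have hq2 : (2 : ℝ) ≤ q := by exact_mod_cast hj2.trans hjq
  have hq0 : (0 : ℝ) < q := by linarith
  have hbound : ∀ K, _ := aux_main_bound s x B hs0.le hB q (by omega) (cfP x j)
    (by rw [← hq]; exact aux_cop x j) (by omega)
  have hHdef : x - (cfP x j : ℝ) / (q : ℝ) = cfH x j := by unfold cfH; rw [hq]; simp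
  rw [hHdef] at hbound
  have hHpos : 0 < |cfH x j| := abs_pos.2 (aux_H_ne x hirr j)
  have hHlt : |cfH x j| < (q : ℝ) ^ (-ρ) := by
    have h3 : ρ < cfR x j := (ENNReal.lt_ofReal_iff_toReal_lt hρtop).1 hjr
    unfold cfR at h3
    rw [hq] at h3
    have : Real.logb (q : ℝ) |cfH x j| < -ρ := by push_cast at h3; linarith
    exact (Real.logb_lt_iff_lt_rpow (by linarith) hHpos).1 this
  set H := |cfH x j|
  -- choose K
  set R : ℝ := 1 / √H with hR
  have hsH : 0 < √H := Real.sqrt_pos.2 hHpos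
  have hR0 : 0 < R := by positivity
  have hRR : H * R ^ 2 = 1 := by
    rw [hR, div_pow, Real.sq_sqrt hHpos.le]; field_simp
  have hRge : (q : ℝ) ^ (ρ / 2) ≤ R := by
    have : ((q : ℝ) ^ (ρ / 2)) ^ 2 ≤ R ^ 2 := by
      have e1 : ((q : ℝ) ^ (ρ / 2)) ^ 2 = (q : ℝ) ^ ρ := by
        rw [← Real.rpow_natCast, ← Real.rpow_mul hq0.le]; congr 1; push_cast; ring
      rw [e1]
      have e2 : (q : ℝ) ^ (-ρ) * (q : ℝ) ^ ρ = 1 := by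
        rw [← Real.rpow_add hq0]; simp
      have e3 : (0 : ℝ) < (q : ℝ) ^ ρ := by positivity
      have e4 : H * (q : ℝ) ^ ρ ≤ H * R ^ 2 := by
        rw [hRR, ← e2]; gcongr
      exact le_of_mul_le_mul_left e4 hHpos
    exact le_of_sq_le_sq this hR0.le
  have hRq : (q : ℝ) ≤ R := by
    refine le_trans ?_ hRge
    calc (q : ℝ) = (q : ℝ) ^ (1 : ℝ) := (Real.rpow_one _).symm
      _ ≤ _ := Real.rpow_le_rpow_of_exponent_le (by linarith) (by linarith)
  set K : ℕ := ⌊R / q⌋₊ with hK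
  have hK1 : 1 ≤ K := by
    rw [hK, Nat.one_le_floor_iff, one_le_div hq0]; exact hRq
  have hKle : (K : ℝ) * q ≤ R := by
    rw [← le_div_iff₀ hq0]; exact Nat.floor_le (by positivity)
  have hKgt : R < 2 * (K * q : ℝ) := by
    have : R / q < K + 1 := Nat.lt_floor_add_one _
    rw [div_lt_iff₀ hq0] at this
    have hK1' : (1 : ℝ) ≤ K := by exact_mod_cast hK1
    nlinarith
  have hb := hbound K
  set N : ℝ := (K : ℝ) * q with hN
  have hN1 : 1 ≤ N := by
    have hK1' : (1 : ℝ) ≤ K := by exact_mod_cast hK1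
    nlinarith
  have hN0 : 0 < N := by linarith
  have hcast : ((K * q + 1 : ℕ) : ℝ) = N + 1 := by push_cast; rfl
  rw [hcast] at hb
  have hb2 : (K : ℝ) * √q ≤ 120 * B * N ^ s := by
    refine hb.trans ?_
    have f1 : (N + 1) ^ s ≤ 2 * N ^ s := by
      calc (N + 1) ^ s ≤ (2 * N) ^ s := Real.rpow_le_rpow (by linarith) (by linarith) hs0.le
        _ = 2 ^ s * N ^ s := Real.mul_rpow (by norm_num) hN0.le
        _ ≤ 2 ^ (1 : ℝ) * N ^ s := by
          gcongr
          · norm_num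
          · exact hs.2
        _ = _ := by rw [Real.rpow_one]
    have f2 : H * (N + 1) ^ 2 ≤ 4 := by
      have g : (N + 1) ^ 2 ≤ (2 * R) ^ 2 := pow_le_pow_left₀ (by linarith) (by linarith) 2
      have g' := mul_le_mul_of_nonneg_left g hHpos.le
      have g2 : H * (2 * R) ^ 2 = 4 * (H * R ^ 2) := by ring
      rw [g2, hRR] at g'
      linarith
    have f3 : 1 + 2 * π * H * (N + 1) ^ 2 ≤ 30 := by
      have g := Real.pi_lt_d2
      have g' := mul_le_mul_of_nonneg_left f2 (by positivity : 0 ≤ 2 * π)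
      have g2 : 2 * π * H * (N + 1) ^ 2 = 2 * π * (H * (N + 1) ^ 2) := by ring
      rw [g2]
      linarith
    calc 2 * B * ((N + 1) ^ s * (1 + 2 * π * H * (N + 1) ^ 2))
        ≤ 2 * B * ((2 * N ^ s) * 30) := by gcongr
      _ = _ := by ring
  have hsq : √(q : ℝ) = (q : ℝ) ^ (1 / 2 : ℝ) := Real.sqrt_eq_rpow _
  have hb3 : N ^ (1 - s) ≤ 120 * B * √q := by
    have g1 : N ^ (1 - s) * N ^ s = N := by
      rw [← Real.rpow_add hN0]; simp
    have g2 : N = K * √q * √q := by rw [mul_assoc, Real.mul_self_sqrt hq0.le]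
    have g3 : 0 < N ^ s := by positivity
    refine le_of_mul_le_mul_right ?_ g3
    rw [g1, g2, ← g2]
    calc N = K * √q * √q := g2
      _ ≤ (120 * B * N ^ s) * √q := by gcongr
      _ = _ := by ring
  have hb4 : (q : ℝ) ^ (ρ * (1 - s) / 2) ≤ 2 * N ^ (1 - s) := by
    calc (q : ℝ) ^ (ρ * (1 - s) / 2) = ((q : ℝ) ^ (ρ / 2)) ^ (1 - s) := by
          rw [← Real.rpow_mul hq0.le]; congr 1; ring
      _ ≤ (2 * N) ^ (1 - s) := by
          apply Real.rpow_le_rpow (by positivity) (hRge.trans hKgt.le) h1s.le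
      _ = 2 ^ (1 - s) * N ^ (1 - s) := Real.mul_rpow (by norm_num) hN0.le
      _ ≤ 2 ^ (1 : ℝ) * N ^ (1 - s) := by
          gcongr
          · norm_num
          · linarith
      _ = _ := by rw [Real.rpow_one]
  have hb5 : (q : ℝ) ^ e ≤ 240 * B := by
    have g1 : (q : ℝ) ^ e * √q = (q : ℝ) ^ (ρ * (1 - s) / 2) := by
      rw [hsq, ← Real.rpow_add hq0]; congr 1; rw [he]; ring
    have g3 : 0 < √(q : ℝ) := Real.sqrt_pos.2 hq0
    refine le_of_mul_le_mul_right ?_ g3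
    rw [g1]
    linarith
  have hb6 : (j : ℝ) ^ e ≤ (q : ℝ) ^ e :=
    Real.rpow_le_rpow (by positivity) (by exact_mod_cast hjq) he0.le
  linarith
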